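/- If W₁ and W₂ are BMSCs with finite output alphabets, then the polar transforms ⟨W₁,W₂⟩⁻ and ⟨W₁,W₂⟩⁺ are again BMSCs, i.e., each admits an involution of its output alphabet exchanging the two conditional output distributions. -/

import Mathlib

open Finset

section Channels

variable {Y Y₁ Y₂ : Type*}

/-- A binary-input channel with finite output alphabet: nonnegative entries,
each row summing to one. -/
def IsChannel [Fintype Y] (W : ZMod 2 → Y → ℝ) : Prop :=
  (∀ x y, 0 ≤ W x y) ∧ ∀ x, ∑ y, W x y = 1

/-- A binary-input memoryless symmetric channel (BMSC): a channel admitting an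
involution of the output alphabet exchanging the two conditional distributions. -/
def IsBMSC [Fintype Y] (W : ZMod 2 → Y → ℝ) : Prop :=
  IsChannel W ∧ ∃ π : Y → Y, Function.Involutive π ∧ ∀ y, W 1 y = W 0 (π y)

/-- The Bhattacharyya parameter of a binary-input channel. -/
noncomputable def Zparam [Fintype Y] (W : ZMod 2 → Y → ℝ) : ℝ :=
  ∑ y, Real.sqrt (W 0 y * W 1 y)

/-- The symmetric capacity of a binary-input channel. -/
noncomputable def capacity [Fintype Y] (W : ZMod 2 → Y → ℝ) : ℝ :=
  ∑ x : ZMod 2, ∑ y, (1 / 2) * W x y *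
    Real.logb 2 (W x y / ((1 / 2) * (W 0 y + W 1 y)))

/-- The minus polar transform ⟨W₁,W₂⟩⁻. -/
noncomputable def polarMinus [Fintype Y₁] [Fintype Y₂] (W₁ : ZMod 2 → Y₁ → ℝ)
    (W₂ : ZMod 2 → Y₂ → ℝ) : ZMod 2 → Y₁ × Y₂ → ℝ :=
  fun u₁ y => (1 / 2) * ∑ u₂ : ZMod 2, W₁ (u₁ + u₂) y.1 * W₂ u₂ y.2

/-- The plus polar transform ⟨W₁,W₂⟩⁺, with output (y₁, y₂, u₁). -/
noncomputable def polarPlus [Fintype Y₁] [Fintype Y₂] (W₁ : ZMod 2 → Y₁ → ℝ)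
    (W₂ : ZMod 2 → Y₂ → ℝ) : ZMod 2 → Y₁ × Y₂ × ZMod 2 → ℝ :=
  fun u₂ y => (1 / 2) * W₁ (y.2.2 + u₂) y.1 * W₂ u₂ y.2.1

end Channels

namespace IsChannel

variable {Y₁ Y₂ : Type*} [Fintype Y₁] [Fintype Y₂]
  {W₁ : ZMod 2 → Y₁ → ℝ} {W₂ : ZMod 2 → Y₂ → ℝ}

theorem sum_mul (h₁ : IsChannel W₁) (h₂ : IsChannel W₂) (a b : ZMod 2) :
    ∑ y₁, ∑ y₂, W₁ a y₁ * W₂ b y₂ = 1 := by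
  rw [← Finset.sum_mul_sum, h₁.2, h₂.2, one_mul]

theorem polarMinus (h₁ : IsChannel W₁) (h₂ : IsChannel W₂) :
    IsChannel (polarMinus W₁ W₂) := by
  refine ⟨fun x y => ?_, fun x => ?_⟩
  · exact mul_nonneg (by norm_num)
      (Finset.sum_nonneg fun u _ => mul_nonneg (h₁.1 _ _) (h₂.1 _ _))
  · simp only [_root_.polarMinus]
    rw [← Finset.mul_sum, Finset.sum_comm]
    simp [Fintype.sum_prod_type, h₁.sum_mul h₂]

theorem polarPlus (h₁ : IsChannel W₁) (h₂ : IsChannel W₂) :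
    IsChannel (polarPlus W₁ W₂) := by
  refine ⟨fun x y => ?_, fun x => ?_⟩
  · exact mul_nonneg (mul_nonneg (by norm_num) (h₁.1 _ _)) (h₂.1 _ _)
  · simp only [_root_.polarPlus, mul_assoc]
    rw [← Finset.mul_sum, ← (Equiv.prodAssoc Y₁ Y₂ (ZMod 2)).sum_comp,
      Fintype.sum_prod_type_right]
    simp [Fintype.sum_prod_type, h₁.sum_mul h₂]

end IsChannel

/-- An involution exchanging the two rows of a binary-input channel flips every input. -/
theorem apply_one_add_of_involutive {Y : Type*} {W : ZMod 2 → Y → ℝ} {π : Y → Y}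
    (hπ : Function.Involutive π) (h : ∀ y, W 1 y = W 0 (π y)) (x : ZMod 2) (y : Y) :
    W (1 + x) y = W x (π y) := by
  fin_cases x
  · exact h y
  · exact (congrArg (W 0) (hπ y)).symm.trans (h (π y)).symm

/-- the polar transforms of BMSCs are again BMSCs. -/
theorem polar_isBMSC {Y₁ Y₂ : Type*} [Fintype Y₁] [Fintype Y₂]
    (W₁ : ZMod 2 → Y₁ → ℝ) (W₂ : ZMod 2 → Y₂ → ℝ)
    (hW₁ : IsBMSC W₁) (hW₂ : IsBMSC W₂) :
    IsBMSC (polarMinus W₁ W₂) ∧ IsBMSC (polarPlus W₁ W₂) := by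
  obtain ⟨h₁, π₁, hπ₁, hW₁⟩ := hW₁
  obtain ⟨h₂, π₂, hπ₂, hW₂⟩ := hW₂
  refine ⟨⟨h₁.polarMinus h₂, Prod.map π₁ id, hπ₁.prodMap fun _ => rfl, fun y => ?_⟩,
    ⟨h₁.polarPlus h₂, Prod.map π₁ (Prod.map π₂ id),
      hπ₁.prodMap (hπ₂.prodMap fun _ => rfl), fun y => ?_⟩⟩
  · simp [polarMinus, apply_one_add_of_involutive hπ₁ hW₁]
  · simp [polarPlus, add_comm y.2.2, apply_one_add_of_involutive hπ₁ hW₁, hW₂]
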